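/- Bagderina's third-order quantity J₀ is the negative of the fifth power of the pseudoscalar invariant F: for all smooth P, Q, R, S the identity J₀ = −Φ holds identically on ℝ², where Φ is the quantity denoted F⁵ in the earlier classification. -/

import Mathlib

open Function

noncomputable section

/-- Partial derivative in the first variable. -/
def pdx (f : ℝ → ℝ → ℝ) : ℝ → ℝ → ℝ := fun x y => deriv (fun t => f t y) x

/-- Partial derivative in the second variable. -/
def pdy (f : ℝ → ℝ → ℝ) : ℝ → ℝ → ℝ := fun x y => deriv (fun t => f x t) y

def al0 (P Q R S : ℝ → ℝ → ℝ) : ℝ → ℝ → ℝ := fun x y =>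
  pdx Q x y - pdy P x y + 2 * P x y * R x y - 2 * Q x y ^ 2

def al1 (P Q R S : ℝ → ℝ → ℝ) : ℝ → ℝ → ℝ := fun x y =>
  pdx R x y - pdy Q x y + P x y * S x y - Q x y * R x y

def al2 (P Q R S : ℝ → ℝ → ℝ) : ℝ → ℝ → ℝ := fun x y =>
  pdx S x y - pdy R x y + 2 * Q x y * S x y - 2 * R x y ^ 2

def b1 (P Q R S : ℝ → ℝ → ℝ) : ℝ → ℝ → ℝ := fun x y =>
  pdx (al1 P Q R S) x y - pdy (al0 P Q R S) x y + R x y * al0 P Q R S x y - 2 * Q x y * al1 P Q R S x y + P x y * al2 P Q R S x y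

def b2 (P Q R S : ℝ → ℝ → ℝ) : ℝ → ℝ → ℝ := fun x y =>
  pdx (al2 P Q R S) x y - pdy (al1 P Q R S) x y + S x y * al0 P Q R S x y - 2 * R x y * al1 P Q R S x y + Q x y * al2 P Q R S x y

def g10 (P Q R S : ℝ → ℝ → ℝ) : ℝ → ℝ → ℝ := fun x y =>
  pdx (b1 P Q R S) x y - Q x y * b1 P Q R S x y + P x y * b2 P Q R S x y

def g11 (P Q R S : ℝ → ℝ → ℝ) : ℝ → ℝ → ℝ := fun x y =>
  pdx (b2 P Q R S) x y - R x y * b1 P Q R S x y + Q x y * b2 P Q R S x y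

def g20 (P Q R S : ℝ → ℝ → ℝ) : ℝ → ℝ → ℝ := fun x y =>
  pdy (b1 P Q R S) x y - R x y * b1 P Q R S x y + Q x y * b2 P Q R S x y

def g21 (P Q R S : ℝ → ℝ → ℝ) : ℝ → ℝ → ℝ := fun x y =>
  pdy (b2 P Q R S) x y - S x y * b1 P Q R S x y + R x y * b2 P Q R S x y

def J0 (P Q R S : ℝ → ℝ → ℝ) : ℝ → ℝ → ℝ := fun x y =>
  b2 P Q R S x y ^ 2 * g10 P Q R S x y - b1 P Q R S x y * b2 P Q R S x y * (g20 P Q R S x y + g11 P Q R S x y) + b1 P Q R S x y ^ 2 * g21 P Q R S x y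

def Gam0 (P Q R S : ℝ → ℝ → ℝ) : ℝ → ℝ → ℝ := fun x y =>
  3 * b2 P Q R S x y * g10 P Q R S x y + b1 P Q R S x y * (g20 P Q R S x y - 4 * g11 P Q R S x y)

def Gam1 (P Q R S : ℝ → ℝ → ℝ) : ℝ → ℝ → ℝ := fun x y =>
  b2 P Q R S x y * (4 * g20 P Q R S x y - g11 P Q R S x y) - 3 * b1 P Q R S x y * g21 P Q R S x y

def d10 (P Q R S : ℝ → ℝ → ℝ) : ℝ → ℝ → ℝ := fun x y =>
  pdx (g10 P Q R S) x y - 2 * Q x y * g10 P Q R S x y + P x y * (g20 P Q R S x y + g11 P Q R S x y) - 5 * al0 P Q R S x y * b1 P Q R S x y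

def d20 (P Q R S : ℝ → ℝ → ℝ) : ℝ → ℝ → ℝ := fun x y =>
  pdx (g20 P Q R S) x y - R x y * g10 P Q R S x y + P x y * g21 P Q R S x y - 4 * al1 P Q R S x y * b1 P Q R S x y - al0 P Q R S x y * b2 P Q R S x y

def d30 (P Q R S : ℝ → ℝ → ℝ) : ℝ → ℝ → ℝ := fun x y =>
  pdy (g20 P Q R S) x y - S x y * g10 P Q R S x y + Q x y * g21 P Q R S x y - 4 * al2 P Q R S x y * b1 P Q R S x y - al1 P Q R S x y * b2 P Q R S x y

def d11 (P Q R S : ℝ → ℝ → ℝ) : ℝ → ℝ → ℝ := fun x y =>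
  pdx (g11 P Q R S) x y - R x y * g10 P Q R S x y + P x y * g21 P Q R S x y - al1 P Q R S x y * b1 P Q R S x y - 4 * al0 P Q R S x y * b2 P Q R S x y

def d21 (P Q R S : ℝ → ℝ → ℝ) : ℝ → ℝ → ℝ := fun x y =>
  pdx (g21 P Q R S) x y - R x y * (g20 P Q R S x y + g11 P Q R S x y) + 2 * Q x y * g21 P Q R S x y - 5 * al1 P Q R S x y * b2 P Q R S x y

def d31 (P Q R S : ℝ → ℝ → ℝ) : ℝ → ℝ → ℝ := fun x y =>
  pdy (g21 P Q R S) x y - S x y * (g20 P Q R S x y + g11 P Q R S x y) + 2 * R x y * g21 P Q R S x y - 5 * al2 P Q R S x y * b2 P Q R S x y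

def J1 (P Q R S : ℝ → ℝ → ℝ) : ℝ → ℝ → ℝ := fun x y =>
  b2 P Q R S x y * (d20 P Q R S x y - d11 P Q R S x y) + b1 P Q R S x y * (d21 P Q R S x y - d30 P Q R S x y) + (7 / 5) * (g20 P Q R S x y - g11 P Q R S x y) ^ 2 + (3 / 5) * (g20 P Q R S x y * g11 P Q R S x y - g10 P Q R S x y * g21 P Q R S x y)

def J2 (P Q R S : ℝ → ℝ → ℝ) : ℝ → ℝ → ℝ := fun x y =>
  Gam1 P Q R S x y * (d20 P Q R S x y - d11 P Q R S x y) + Gam0 P Q R S x y * (d21 P Q R S x y - d30 P Q R S x y) + 3 * (g20 P Q R S x y - g11 P Q R S x y) * (g10 P Q R S x y * g21 P Q R S x y - g20 P Q R S x y * g11 P Q R S x y) + (4 / 3) * (g20 P Q R S x y - g11 P Q R S x y) ^ 3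

def J3 (P Q R S : ℝ → ℝ → ℝ) : ℝ → ℝ → ℝ := fun x y =>
  b2 P Q R S x y ^ 3 * d10 P Q R S x y - b1 P Q R S x y * b2 P Q R S x y ^ 2 * (2 * d20 P Q R S x y + d11 P Q R S x y) + b1 P Q R S x y ^ 2 * b2 P Q R S x y * (d30 P Q R S x y + 2 * d21 P Q R S x y) - b1 P Q R S x y ^ 3 * d31 P Q R S x y + 4 * (g20 P Q R S x y - g11 P Q R S x y) * J0 P Q R S x y

def J4 (P Q R S : ℝ → ℝ → ℝ) : ℝ → ℝ → ℝ := fun x y =>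
  -b2 P Q R S x y * (b2 P Q R S x y * Gam0 P Q R S x y + 2 * b1 P Q R S x y * Gam1 P Q R S x y) * (2 * d20 P Q R S x y + d11 P Q R S x y) + b1 P Q R S x y * (2 * b2 P Q R S x y * Gam0 P Q R S x y + b1 P Q R S x y * Gam1 P Q R S x y) * (d30 P Q R S x y + 2 * d21 P Q R S x y) + 3 * b2 P Q R S x y ^ 2 * Gam1 P Q R S x y * d10 P Q R S x y - 3 * b1 P Q R S x y ^ 2 * Gam0 P Q R S x y * d31 P Q R S x y + (66 / 5) * (g20 P Q R S x y - g11 P Q R S x y) ^ 2 * J0 P Q R S x y + (36 / 5) * (g10 P Q R S x y * g21 P Q R S x y - g20 P Q R S x y * g11 P Q R S x y) * J0 P Q R S x y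

def AA (P Q R S : ℝ → ℝ → ℝ) : ℝ → ℝ → ℝ := fun x y =>
  pdy (pdy P) x y - 2 * pdx (pdy Q) x y + pdx (pdx R) x y + 2 * P x y * pdx S x y + S x y * pdx P x y - 3 * P x y * pdy R x y - 3 * R x y * pdy P x y - 3 * Q x y * pdx R x y + 6 * Q x y * pdy Q x y

def BB (P Q R S : ℝ → ℝ → ℝ) : ℝ → ℝ → ℝ := fun x y =>
  pdx (pdx S) x y - 2 * pdx (pdy R) x y + pdy (pdy Q) x y - 2 * S x y * pdy P x y - P x y * pdy S x y + 3 * S x y * pdx Q x y + 3 * Q x y * pdx S x y + 3 * R x y * pdy Q x y - 6 * R x y * pdx R x y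

def GG (P Q R S : ℝ → ℝ → ℝ) : ℝ → ℝ → ℝ := fun x y =>
  -BB P Q R S x y * pdx (BB P Q R S) x y - 3 * AA P Q R S x y * pdy (BB P Q R S) x y + 4 * BB P Q R S x y * pdy (AA P Q R S) x y + 3 * S x y * AA P Q R S x y ^ 2 - 6 * R x y * AA P Q R S x y * BB P Q R S x y + 3 * Q x y * BB P Q R S x y ^ 2

def HH (P Q R S : ℝ → ℝ → ℝ) : ℝ → ℝ → ℝ := fun x y =>
  -AA P Q R S x y * pdy (AA P Q R S) x y - 3 * BB P Q R S x y * pdx (AA P Q R S) x y + 4 * AA P Q R S x y * pdx (BB P Q R S) x y - 3 * P x y * BB P Q R S x y ^ 2 + 6 * Q x y * AA P Q R S x y * BB P Q R S x y - 3 * R x y * AA P Q R S x y ^ 2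

def Phi (P Q R S : ℝ → ℝ → ℝ) : ℝ → ℝ → ℝ := fun x y =>
  AA P Q R S x y * BB P Q R S x y * pdy (AA P Q R S) x y + AA P Q R S x y * BB P Q R S x y * pdx (BB P Q R S) x y - AA P Q R S x y ^ 2 * pdy (BB P Q R S) x y - BB P Q R S x y ^ 2 * pdx (AA P Q R S) x y - P x y * BB P Q R S x y ^ 3 + 3 * Q x y * AA P Q R S x y * BB P Q R S x y ^ 2 - 3 * R x y * AA P Q R S x y ^ 2 * BB P Q R S x y + S x y * AA P Q R S x y ^ 3

def I3v (P Q R S F : ℝ → ℝ → ℝ) : ℝ → ℝ → ℝ := fun x y =>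
  BB P Q R S x y * (HH P Q R S x y * pdx (GG P Q R S) x y - GG P Q R S x y * pdx (HH P Q R S) x y) / (3 * F x y ^ 9) - AA P Q R S x y * (HH P Q R S x y * pdy (GG P Q R S) x y - GG P Q R S x y * pdy (HH P Q R S) x y) / (3 * F x y ^ 9) + (HH P Q R S x y * pdy F x y + GG P Q R S x y * pdx F x y) / (3 * F x y ^ 5) + BB P Q R S x y * GG P Q R S x y ^ 2 * P x y / (3 * F x y ^ 9) - (AA P Q R S x y * GG P Q R S x y ^ 2 - 2 * HH P Q R S x y * BB P Q R S x y * GG P Q R S x y) * Q x y / (3 * F x y ^ 9) + (BB P Q R S x y * HH P Q R S x y ^ 2 - 2 * HH P Q R S x y * AA P Q R S x y * GG P Q R S x y) * R x y / (3 * F x y ^ 9) - AA P Q R S x y * HH P Q R S x y ^ 2 * S x y / (3 * F x y ^ 9)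

def I6v (P Q R S F : ℝ → ℝ → ℝ) : ℝ → ℝ → ℝ := fun x y =>
  (pdy (AA P Q R S) x y - pdx (BB P Q R S) x y) / (3 * F x y ^ 2) - (AA P Q R S x y * pdy F x y - BB P Q R S x y * pdx F x y) / (3 * F x y ^ 3)

def I7v (P Q R S F : ℝ → ℝ → ℝ) : ℝ → ℝ → ℝ := fun x y =>
  (GG P Q R S x y * HH P Q R S x y * pdx (GG P Q R S) x y - GG P Q R S x y ^ 2 * pdx (HH P Q R S) x y + HH P Q R S x y ^ 2 * pdy (GG P Q R S) x y - HH P Q R S x y * GG P Q R S x y * pdy (HH P Q R S) x y) / (3 * F x y ^ 11) + (GG P Q R S x y ^ 3 * P x y + 3 * GG P Q R S x y ^ 2 * HH P Q R S x y * Q x y + 3 * GG P Q R S x y * HH P Q R S x y ^ 2 * R x y + HH P Q R S x y ^ 3 * S x y) / (3 * F x y ^ 11)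

def I8v (P Q R S F : ℝ → ℝ → ℝ) : ℝ → ℝ → ℝ := fun x y =>
  GG P Q R S x y * (AA P Q R S x y * pdx (GG P Q R S) x y + BB P Q R S x y * pdx (HH P Q R S) x y) / (3 * F x y ^ 9) + HH P Q R S x y * (AA P Q R S x y * pdy (GG P Q R S) x y + BB P Q R S x y * pdy (HH P Q R S) x y) / (3 * F x y ^ 9) - 10 * (HH P Q R S x y * pdy F x y + GG P Q R S x y * pdx F x y) / (3 * F x y ^ 5) - BB P Q R S x y * GG P Q R S x y ^ 2 * P x y / (3 * F x y ^ 9) + (AA P Q R S x y * GG P Q R S x y ^ 2 - 2 * HH P Q R S x y * BB P Q R S x y * GG P Q R S x y) * Q x y / (3 * F x y ^ 9) - (BB P Q R S x y * HH P Q R S x y ^ 2 - 2 * HH P Q R S x y * AA P Q R S x y * GG P Q R S x y) * R x y / (3 * F x y ^ 9) + AA P Q R S x y * HH P Q R S x y ^ 2 * S x y / (3 * F x y ^ 9)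

def XX (P Q R S F f : ℝ → ℝ → ℝ) : ℝ → ℝ → ℝ := fun x y =>
  (BB P Q R S x y * pdx f x y - AA P Q R S x y * pdy f x y) / F x y ^ 2

def YY (P Q R S F f : ℝ → ℝ → ℝ) : ℝ → ℝ → ℝ := fun x y =>
  (GG P Q R S x y * pdx f x y + HH P Q R S x y * pdy f x y) / F x y ^ 4

def IBgd1 (P Q R S F : ℝ → ℝ → ℝ) : ℝ → ℝ → ℝ := fun x y =>
  J1 P Q R S x y / F x y ^ 4

def IBgd2 (P Q R S F : ℝ → ℝ → ℝ) : ℝ → ℝ → ℝ := fun x y =>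
  J2 P Q R S x y / F x y ^ 6

def IBgd3 (P Q R S F : ℝ → ℝ → ℝ) : ℝ → ℝ → ℝ := fun x y =>
  -(J3 P Q R S x y / F x y ^ 7)

def IBgd4 (P Q R S F : ℝ → ℝ → ℝ) : ℝ → ℝ → ℝ := fun x y =>
  -(J4 P Q R S x y / F x y ^ 9)


theorem ContDiff.comp_fst_uncurry {n : WithTop ℕ∞} {f : ℝ → ℝ → ℝ}
    (hf : ContDiff ℝ n (uncurry f)) (y : ℝ) : ContDiff ℝ n fun t => f t y :=
  hf.comp (contDiff_id.prodMk contDiff_const)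

theorem ContDiff.comp_snd_uncurry {n : WithTop ℕ∞} {f : ℝ → ℝ → ℝ}
    (hf : ContDiff ℝ n (uncurry f)) (x : ℝ) : ContDiff ℝ n fun t => f x t :=
  hf.comp (contDiff_const.prodMk contDiff_id)

theorem pdx_eq_fderiv {f : ℝ → ℝ → ℝ} (hf : Differentiable ℝ (uncurry f)) (x y : ℝ) :
    pdx f x y = fderiv ℝ (uncurry f) (x, y) (1, 0) :=
  (HasFDerivAt.comp_hasDerivAt (f := fun t => (t, y)) x (hf (x, y)).hasFDerivAt
    ((hasDerivAt_id x).prodMk (hasDerivAt_const x y))).deriv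

theorem pdy_eq_fderiv {f : ℝ → ℝ → ℝ} (hf : Differentiable ℝ (uncurry f)) (x y : ℝ) :
    pdy f x y = fderiv ℝ (uncurry f) (x, y) (0, 1) :=
  (HasFDerivAt.comp_hasDerivAt (f := fun t => (x, t)) y (hf (x, y)).hasFDerivAt
    ((hasDerivAt_const y x).prodMk (hasDerivAt_id y))).deriv

theorem uncurry_pdx {f : ℝ → ℝ → ℝ} (hf : Differentiable ℝ (uncurry f)) :
    uncurry (pdx f) = fun p => fderiv ℝ (uncurry f) p (1, 0) :=
  funext fun p => pdx_eq_fderiv hf p.1 p.2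

theorem uncurry_pdy {f : ℝ → ℝ → ℝ} (hf : Differentiable ℝ (uncurry f)) :
    uncurry (pdy f) = fun p => fderiv ℝ (uncurry f) p (0, 1) :=
  funext fun p => pdy_eq_fderiv hf p.1 p.2

theorem ContDiff.uncurry_pdx {m n : WithTop ℕ∞} {f : ℝ → ℝ → ℝ}
    (hf : ContDiff ℝ n (uncurry f)) (hmn : m + 1 ≤ n) : ContDiff ℝ m (uncurry (pdx f)) := by
  rw [_root_.uncurry_pdx ((hf.of_le (le_add_self.trans hmn)).differentiable one_ne_zero)]
  exact (hf.fderiv_right hmn).clm_apply contDiff_const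

theorem ContDiff.uncurry_pdy {m n : WithTop ℕ∞} {f : ℝ → ℝ → ℝ}
    (hf : ContDiff ℝ n (uncurry f)) (hmn : m + 1 ≤ n) : ContDiff ℝ m (uncurry (pdy f)) := by
  rw [_root_.uncurry_pdy ((hf.of_le (le_add_self.trans hmn)).differentiable one_ne_zero)]
  exact (hf.fderiv_right hmn).clm_apply contDiff_const

theorem pdy_pdx_eq_pdx_pdy {f : ℝ → ℝ → ℝ} (hf : ContDiff ℝ 2 (uncurry f)) :
    pdy (pdx f) = pdx (pdy f) := by
  have h21 : (1 : WithTop ℕ∞) + 1 ≤ 2 := one_add_one_eq_two.le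
  have hd : Differentiable ℝ (uncurry f) := hf.differentiable two_ne_zero
  have hd2 : Differentiable ℝ (fderiv ℝ (uncurry f)) :=
    (hf.fderiv_right h21).differentiable one_ne_zero
  funext x y
  rw [pdy_eq_fderiv ((hf.uncurry_pdx h21).differentiable one_ne_zero),
    pdx_eq_fderiv ((hf.uncurry_pdy h21).differentiable one_ne_zero),
    uncurry_pdx hd, uncurry_pdy hd,
    fderiv_clm_apply (hd2 _) (differentiableAt_const _),
    fderiv_clm_apply (hd2 _) (differentiableAt_const _)]
  simpa using (hf.contDiffAt (x := (x, y))).isSymmSndFDerivAt (by simp) (0, 1) (1, 0)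

theorem hasDerivAt_pdx {f : ℝ → ℝ → ℝ} (hf : ContDiff ℝ 1 (uncurry f)) (x y : ℝ) :
    HasDerivAt (fun t => f t y) (pdx f x y) x :=
  ((hf.comp_fst_uncurry y).differentiable one_ne_zero x).hasDerivAt

theorem hasDerivAt_pdy {f : ℝ → ℝ → ℝ} (hf : ContDiff ℝ 1 (uncurry f)) (x y : ℝ) :
    HasDerivAt (fun t => f x t) (pdy f x y) y :=
  ((hf.comp_snd_uncurry x).differentiable one_ne_zero y).hasDerivAt

theorem b1_eq_AA {P Q R S : ℝ → ℝ → ℝ}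
    (hP : ContDiff ℝ 2 (uncurry P)) (hQ : ContDiff ℝ 2 (uncurry Q))
    (hR : ContDiff ℝ 2 (uncurry R)) (hS : ContDiff ℝ 2 (uncurry S)) :
    b1 P Q R S = AA P Q R S := by
  have h21 : (1 : WithTop ℕ∞) + 1 ≤ 2 := one_add_one_eq_two.le
  have h1 {f : ℝ → ℝ → ℝ} (hf : ContDiff ℝ 2 (uncurry f)) : ContDiff ℝ 1 (uncurry f) :=
    hf.of_le one_le_two
  funext x y
  have hx : pdx (al1 P Q R S) x y = _ := HasDerivAt.deriv <|
    ((((hasDerivAt_pdx (hR.uncurry_pdx h21) x y).sub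
      (hasDerivAt_pdx (hQ.uncurry_pdy h21) x y)).add
      ((hasDerivAt_pdx (h1 hP) x y).mul (hasDerivAt_pdx (h1 hS) x y))).sub
      ((hasDerivAt_pdx (h1 hQ) x y).mul (hasDerivAt_pdx (h1 hR) x y)))
  have hy : pdy (al0 P Q R S) x y = _ := HasDerivAt.deriv <|
    ((((hasDerivAt_pdy (hQ.uncurry_pdx h21) x y).sub
      (hasDerivAt_pdy (hP.uncurry_pdy h21) x y)).add
      (((hasDerivAt_pdy (h1 hP) x y).const_mul 2).mul (hasDerivAt_pdy (h1 hR) x y))).sub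
      (((hasDerivAt_pdy (h1 hQ) x y).pow 2).const_mul 2))
  simp only [b1, AA, hx, hy, al0, al1, al2, pdy_pdx_eq_pdx_pdy hQ]
  ring

theorem b2_eq_BB {P Q R S : ℝ → ℝ → ℝ}
    (hP : ContDiff ℝ 2 (uncurry P)) (hQ : ContDiff ℝ 2 (uncurry Q))
    (hR : ContDiff ℝ 2 (uncurry R)) (hS : ContDiff ℝ 2 (uncurry S)) :
    b2 P Q R S = BB P Q R S := by
  have h21 : (1 : WithTop ℕ∞) + 1 ≤ 2 := one_add_one_eq_two.le
  have h1 {f : ℝ → ℝ → ℝ} (hf : ContDiff ℝ 2 (uncurry f)) : ContDiff ℝ 1 (uncurry f) :=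
    hf.of_le one_le_two
  funext x y
  have hx : pdx (al2 P Q R S) x y = _ := HasDerivAt.deriv <|
    ((((hasDerivAt_pdx (hS.uncurry_pdx h21) x y).sub
      (hasDerivAt_pdx (hR.uncurry_pdy h21) x y)).add
      (((hasDerivAt_pdx (h1 hQ) x y).const_mul 2).mul (hasDerivAt_pdx (h1 hS) x y))).sub
      (((hasDerivAt_pdx (h1 hR) x y).pow 2).const_mul 2))
  have hy : pdy (al1 P Q R S) x y = _ := HasDerivAt.deriv <|
    ((((hasDerivAt_pdy (hR.uncurry_pdx h21) x y).sub
      (hasDerivAt_pdy (hQ.uncurry_pdy h21) x y)).add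
      ((hasDerivAt_pdy (h1 hP) x y).mul (hasDerivAt_pdy (h1 hS) x y))).sub
      ((hasDerivAt_pdy (h1 hQ) x y).mul (hasDerivAt_pdy (h1 hR) x y)))
  simp only [b2, BB, hx, hy, al0, al1, al2, pdy_pdx_eq_pdx_pdy hR]
  ring

theorem stmt1 (P Q R S : ℝ → ℝ → ℝ)
    (hP : ContDiff ℝ (⊤ : ℕ∞) (uncurry P)) (hQ : ContDiff ℝ (⊤ : ℕ∞) (uncurry Q))
    (hR : ContDiff ℝ (⊤ : ℕ∞) (uncurry R)) (hS : ContDiff ℝ (⊤ : ℕ∞) (uncurry S)) :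
    ∀ x y : ℝ, J0 P Q R S x y = - Phi P Q R S x y := by
  intro x y
  have h2 {f : ℝ → ℝ → ℝ} (hf : ContDiff ℝ (⊤ : ℕ∞) (uncurry f)) : ContDiff ℝ 2 (uncurry f) :=
    hf.of_le (WithTop.coe_le_coe.2 le_top)
  simp only [J0, Phi, g10, g11, g20, g21, b1_eq_AA (h2 hP) (h2 hQ) (h2 hR) (h2 hS),
    b2_eq_BB (h2 hP) (h2 hQ) (h2 hR) (h2 hS)]
  ring
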